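/- There does not exist a nontrivial regular partial difference set with parameters (v,k,λ,μ) = (2985984, 622440, 128952, 129960) in any abelian group G of order 2985984 = 2¹²·3⁶. -/

import Mathlib

/-- `D` is a `(v,k,λ,μ)` partial difference set in the group `G` (written
multiplicatively): `|G| = v`, `|D| = k`, every non-identity element of `D` is represented
exactly `lam` times as `g * h⁻¹` with `g, h ∈ D`, `g ≠ h`, and every non-identity element
of `G` not in `D` exactly `mu` times. -/
def IsPDS {G : Type*} [Group G] (D : Set G) (v k lam mu : ℕ) : Prop :=
  Nat.card G = v ∧ D.ncard = k ∧
  (∀ z : G, z ≠ 1 → z ∈ D →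
    {p : G × G | p.1 ∈ D ∧ p.2 ∈ D ∧ p.1 ≠ p.2 ∧ p.1 * p.2⁻¹ = z}.ncard = lam) ∧
  (∀ z : G, z ≠ 1 → z ∉ D →
    {p : G × G | p.1 ∈ D ∧ p.2 ∈ D ∧ p.1 ≠ p.2 ∧ p.1 * p.2⁻¹ = z}.ncard = mu)

/-- `D` is regular: it avoids the identity and is closed under inversion. -/
def IsRegularPDS {G : Type*} [Group G] (D : Set G) : Prop :=
  (1 : G) ∉ D ∧ ∀ g ∈ D, g⁻¹ ∈ D

/-- `D` is a trivial PDS: `D ∪ {1}` or `G \ D` is a subgroup of `G`. -/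
def IsTrivialPDS {G : Type*} [Group G] (D : Set G) : Prop :=
  (∃ H : Subgroup G, D ∪ {1} = (H : Set G)) ∨ ∃ H : Subgroup G, Dᶜ = (H : Set G)

/-- Square of a character sum over a symmetric set. -/
theorem charsum_sq {A : Type*} [AddCommGroup A] (D : Finset A)
    (hneg : ∀ a ∈ D, -a ∈ D) (χ : AddChar A ℂ) :
    (∑ d ∈ D, χ d) ^ 2 = ∑ p ∈ D ×ˢ D, χ (p.1 - p.2) := by
  have h : ∑ d ∈ D, χ d = ∑ d ∈ D, χ (-d) := by
    refine Finset.sum_nbij' (fun a => -a) (fun a => -a) ?_ ?_ ?_ ?_ ?_ <;> simp +contextual [hneg]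
  rw [sq]
  nth_rewrite 2 [h]
  rw [Finset.sum_mul_sum, Finset.sum_product]
  simp [sub_eq_add_neg, AddChar.map_add_eq_mul]

theorem charsum_values {A : Type*} [AddCommGroup A] [Fintype A] [DecidableEq A] (D : Finset A)
    (hk : D.card = 622440) (h0 : (0 : A) ∉ D) (hneg : ∀ a ∈ D, -a ∈ D)
    (hl : ∀ z : A, z ≠ 0 → z ∈ D → ((D ×ˢ D).filter (fun p => p.1 - p.2 = z)).card = 128952)
    (hm : ∀ z : A, z ≠ 0 → z ∉ D → ((D ×ˢ D).filter (fun p => p.1 - p.2 = z)).card = 129960)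
    (χ : AddChar A ℂ) (hχ : χ ≠ 0) :
    ∑ d ∈ D, χ d = 360 ∨ ∑ d ∈ D, χ d = -1368 := by
  have hz : ((D ×ˢ D).filter (fun p => p.1 - p.2 = 0)).card = 622440 := by
    rw [← hk]
    refine Finset.card_nbij' (fun p => p.1) (fun a => (a, a)) ?_ ?_ ?_ ?_
    · intro p; simp +contextual
    · intro p; simp +contextual
    · rintro ⟨a, b⟩; simp +contextual [sub_eq_zero]
    · intro p; simp
  have key : (∑ d ∈ D, χ d) ^ 2 = 492480 + (-1008) * ∑ d ∈ D, χ d := by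
    rw [charsum_sq D hneg χ]
    rw [← Finset.sum_fiberwise (D ×ˢ D) (fun p => p.1 - p.2)]
    have h1 : ∀ z : A, ∑ p ∈ (D ×ˢ D).filter (fun p => p.1 - p.2 = z), χ (p.1 - p.2)
        = 129960 * χ z + (if z ∈ D then (-1008) * χ z else 0) + (if z = 0 then 492480 else 0) := by
      intro z
      have : ∑ p ∈ (D ×ˢ D).filter (fun p => p.1 - p.2 = z), χ (p.1 - p.2)
          = (((D ×ˢ D).filter (fun p => p.1 - p.2 = z)).card : ℂ) * χ z := by
        rw [← nsmul_eq_mul, ← Finset.sum_const]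
        refine Finset.sum_congr rfl fun p hp => ?_
        rw [(Finset.mem_filter.1 hp).2]
      rw [this]
      by_cases hz0 : z = 0
      · subst hz0
        rw [hz]; simp [h0]; norm_num
      · by_cases hzD : z ∈ D
        · rw [hl z hz0 hzD]; simp [hz0, hzD]; ring
        · rw [hm z hz0 hzD]; simp [hz0, hzD]
    rw [Finset.sum_congr rfl fun z _ => h1 z]
    rw [Finset.sum_add_distrib, Finset.sum_add_distrib, ← Finset.mul_sum,
      AddChar.sum_eq_zero_iff_ne_zero.2 hχ, Finset.sum_ite_mem, Finset.univ_inter,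
      ← Finset.mul_sum]
    simp
    ring
  have : (∑ d ∈ D, χ d - 360) * (∑ d ∈ D, χ d + 1368) = 0 := by linear_combination key
  rcases mul_eq_zero.1 this with h | h
  · left; linear_combination h
  · right; linear_combination h

theorem addChar_isIntegral {A : Type*} [AddCommGroup A] [Finite A] (χ : AddChar A ℂ) (a : A) :
    IsIntegral ℤ (χ a) := by
  have : (χ a) ^ (Nat.card A) = 1 := by
    rw [← AddChar.map_nsmul_eq_pow, card_nsmul_eq_zero', AddChar.map_zero_eq_one]
  exact IsIntegral.of_pow (Nat.card_pos) (this ▸ isIntegral_one)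

theorem int_aux1 (z : ℂ) (hz : IsIntegral ℤ z) (q : ℚ) (h : z = (q : ℂ)) :
    ∃ n : ℤ, z = (n : ℂ) := by
  have h2 : z = algebraMap ℚ ℂ q := by simpa using h
  rw [h2] at hz
  have h3 := (isIntegral_algebraMap_iff (algebraMap ℚ ℂ).injective).1 hz
  obtain ⟨n, hn⟩ := IsIntegrallyClosed.isIntegral_iff.1 h3
  refine ⟨n, ?_⟩
  rw [h2, ← hn]
  simp

theorem int_aux2 (n m : ℤ) (h : 27 * n = 9720 - 64 * m) : ∃ t : ℤ, n = 40 + 64 * t := by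
  refine ⟨2885 - 19 * m - 8 * n, ?_⟩
  linarith

theorem int_of_integral (z : ℂ) (hz : IsIntegral ℤ z) (m : ℕ) (h : 27 * z = 9720 - 64 * m) :
    ∃ t : ℤ, z = ((40 + 64 * t : ℤ) : ℂ) := by
  obtain ⟨n, hn⟩ := int_aux1 z hz ((9720 - 64 * m) / 27) (by push_cast; linear_combination h / 27)
  have h4 : (27 * n : ℤ) = 9720 - 64 * (m : ℤ) := by
    have h5 : ((27 * n : ℤ) : ℂ) = ((9720 - 64 * (m : ℤ) : ℤ) : ℂ) := by
      push_cast; rw [← hn]; exact h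
    exact Int.cast_injective h5
  obtain ⟨t, ht⟩ := int_aux2 n m h4
  exact ⟨t, by rw [hn, ht]⟩

theorem pds_core {A : Type*} [AddCommGroup A] [Fintype A] [DecidableEq A] (D : Finset A)
    (hv : Fintype.card A = 2985984)
    (hk : D.card = 622440) (h0 : (0 : A) ∉ D) (hneg : ∀ a ∈ D, -a ∈ D)
    (hl : ∀ z : A, z ≠ 0 → z ∈ D → ((D ×ˢ D).filter (fun p => p.1 - p.2 = z)).card = 128952)
    (hm : ∀ z : A, z ≠ 0 → z ∉ D → ((D ×ˢ D).filter (fun p => p.1 - p.2 = z)).card = 129960)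
    (N : AddSubgroup A) (hN : Nat.card N = 4096) : False := by
  classical
  have hX := charsum_values D hk h0 hneg hl hm
  have hQ : Fintype.card (A ⧸ N) = 729 := by
    have := AddSubgroup.card_eq_card_quotient_mul_card_addSubgroup N
    rw [hN, Nat.card_eq_fintype_card, hv, Nat.card_eq_fintype_card] at this
    omega
  set E : Finset A := D.filter (· ∈ N) with hE
  have hEneg : ∀ a ∈ E, -a ∈ E := by
    intro a ha
    simp only [hE, Finset.mem_filter] at ha ⊢
    exact ⟨hneg a ha.1, N.neg_mem ha.2⟩
  let f : AddChar A ℂ → ℂ := fun χ => ∑ d ∈ E, χ d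
  let L : AddChar (A ⧸ N) ℂ → AddChar A ℂ := fun ψ => ψ.compAddMonoidHom (QuotientAddGroup.mk' N)
  have hLapp : ∀ ψ a, L ψ a = ψ (a : A ⧸ N) := fun ψ a => rfl
  -- averaging over characters of the quotient
  have havg : ∀ χ : AddChar A ℂ, 729 * f χ = ∑ ψ : AddChar (A ⧸ N) ℂ, ∑ d ∈ D, (χ * L ψ) d := by
    intro χ
    rw [Finset.sum_comm]
    have : ∀ d ∈ D, ∑ ψ : AddChar (A ⧸ N) ℂ, (χ * L ψ) d = if d ∈ N then 729 * χ d else 0 := by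
      intro d _
      simp only [AddChar.mul_apply, hLapp]
      rw [← Finset.mul_sum, AddChar.sum_apply_eq_ite, hQ]
      simp only [QuotientAddGroup.eq_zero_iff]
      split_ifs <;> simp [mul_comm]
    rw [Finset.sum_congr rfl this, ← Finset.sum_filter, ← Finset.mul_sum]
  -- nontrivial on N
  have hnt : ∀ χ : AddChar A ℂ, ¬ (∀ n ∈ N, χ n = 1) → ∃ t : ℤ, f χ = ((40 + 64 * t : ℤ) : ℂ) := by
    intro χ hχ
    have hne : ∀ ψ, χ * L ψ ≠ 0 := by
      intro ψ h
      apply hχ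
      intro n hn
      have h2 : (χ * L ψ) n = 1 := by rw [h]; simp
      rw [AddChar.mul_apply, hLapp, (QuotientAddGroup.eq_zero_iff n).2 hn] at h2
      simpa using h2
    refine int_of_integral _ (IsIntegral.sum _ fun d _ => addChar_isIntegral χ d)
      (Finset.univ.filter fun ψ => ∑ d ∈ D, (χ * L ψ) d = -1368).card ?_
    have h1 : ∀ ψ : AddChar (A ⧸ N) ℂ, ∑ d ∈ D, (χ * L ψ) d
        = 360 - 1728 * (if ∑ d ∈ D, (χ * L ψ) d = -1368 then 1 else 0) := by
      intro ψ
      rcases hX _ (hne ψ) with h | h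
      · rw [h]; norm_num
      · rw [h]; norm_num
    have h2 := havg χ
    rw [Finset.sum_congr rfl fun ψ _ => h1 ψ, Finset.sum_sub_distrib, ← Finset.mul_sum,
      Finset.sum_boole, Finset.sum_const, Finset.card_univ, AddChar.card_eq, hQ] at h2
    simp only [nsmul_eq_mul] at h2
    rw [Nat.cast_ofNat] at h2
    linear_combination h2 / 27
  -- trivial on N
  have htr : ∀ χ : AddChar A ℂ, (∀ n ∈ N, χ n = 1) → f χ = (E.card : ℂ) := by
    intro χ hχ
    simp only [f]
    rw [Finset.sum_congr rfl fun d hd => hχ d (Finset.mem_filter.1 hd).2, Finset.sum_const, nsmul_eq_mul, mul_one]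
  have hk0 : E.card ≤ 1213 := by
    have h1 := havg 0
    rw [htr 0 (by simp)] at h1
    have h2 := congrArg Complex.re h1
    rw [Complex.re_sum] at h2
    have h3 : ∀ ψ : AddChar (A ⧸ N) ℂ,
        (∑ d ∈ D, ((0 : AddChar A ℂ) * L ψ) d).re ≤ 360 + if ψ = 0 then 622080 else 0 := by
      intro ψ
      by_cases hψ : ψ = 0
      · subst hψ
        simp [hLapp, hk]; norm_num
      · have : (0 : AddChar A ℂ) * L ψ ≠ 0 := by
          intro h
          apply hψ
          ext q
          obtain ⟨a, rfl⟩ := QuotientAddGroup.mk_surjective q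
          have h2 : ((0 : AddChar A ℂ) * L ψ) a = 1 := by rw [h]; simp
          simpa [hLapp] using h2
        rcases hX _ this with h | h
        · rw [h]; simp [hψ]
        · rw [h]; simp [hψ]; norm_num
    have h4 := Finset.sum_le_sum fun ψ (_ : ψ ∈ Finset.univ) => h3 ψ
    rw [← h2, Finset.sum_add_distrib, Finset.sum_const, Finset.card_univ, AddChar.card_eq, hQ] at h4
    simp at h4
    have h5 : 729 * E.card ≤ 729 * 360 + 622080 := by exact_mod_cast h4
    omega
  -- the sums
  have hs1 : ∑ χ, f χ = 0 := by
    simp only [f]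
    rw [Finset.sum_comm]
    refine Finset.sum_eq_zero fun d hd => ?_
    rw [AddChar.sum_apply_eq_ite, if_neg]
    rintro rfl
    exact h0 (Finset.mem_filter.1 hd).1
  have hs2 : ∑ χ, f χ ^ 2 = 2985984 * E.card := by
    simp only [f]
    rw [Finset.sum_congr rfl fun χ _ => charsum_sq E hEneg χ, Finset.sum_comm]
    simp only [AddChar.sum_apply_eq_ite, hv, sub_eq_zero]
    rw [Finset.sum_product]
    simp [mul_comm]
  have hcount : (Finset.univ.filter fun χ : AddChar A ℂ => ∀ n ∈ N, χ n = 1).card = 729 := by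
    have h1 : ∑ χ : AddChar A ℂ, ∑ n : N, χ n = 2985984 := by
      rw [Finset.sum_comm]
      simp [AddChar.sum_apply_eq_ite, hv]
    have h2 : ∀ χ : AddChar A ℂ, ∑ n : N, χ n = 4096 * if (∀ n ∈ N, χ n = 1) then 1 else 0 := by
      intro χ
      have h3 := AddChar.sum_eq_ite (χ.compAddMonoidHom N.subtype)
      have h4 : χ.compAddMonoidHom N.subtype = 0 ↔ ∀ n ∈ N, χ n = 1 := by
        constructor
        · intro h n hn
          have := DFunLike.congr_fun h (⟨n, hn⟩ : N)
          simpa using this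
        · intro h
          ext n
          simpa using h n n.2
      rw [← Nat.card_eq_fintype_card, hN] at h3
      simp only [h4] at h3
      simpa using h3
    rw [Finset.sum_congr rfl fun χ _ => h2 χ, ← Finset.mul_sum, Finset.sum_boole] at h1
    have h5 : 4096 * (Finset.univ.filter fun χ : AddChar A ℂ => ∀ n ∈ N, χ n = 1).card
      = 2985984 := by exact_mod_cast h1
    omega
  have hs3 : ∑ χ, (f χ - 40) * (f χ + 24) = 2985984 * ((E.card : ℂ) - 960) := by
    have : ∀ χ, (f χ - 40) * (f χ + 24) = f χ ^ 2 - 16 * f χ - 960 := fun χ => by ring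
    rw [Finset.sum_congr rfl fun χ _ => this χ, Finset.sum_sub_distrib, Finset.sum_sub_distrib,
      ← Finset.mul_sum, hs1, hs2, Finset.sum_const, Finset.card_univ, AddChar.card_eq, hv]
    simp
    ring
  have hre := congrArg Complex.re hs3
  rw [Complex.re_sum] at hre
  have hlow : ∀ χ : AddChar A ℂ, (((E.card : ℝ) - 40) * (E.card + 24)) *
      (if (∀ n ∈ N, χ n = 1) then 1 else 0) ≤ ((f χ - 40) * (f χ + 24)).re := by
    intro χ
    split_ifs with h
    · rw [htr χ h]
      simp
    · obtain ⟨t, ht⟩ := hnt χ h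
      have h1 : (f χ - 40) * (f χ + 24) = ((4096 * (t * (t + 1)) : ℤ) : ℂ) := by
        rw [ht]; push_cast; ring
      rw [h1, Complex.intCast_re, mul_zero]
      have : 0 ≤ t * (t + 1) := by
        rcases le_or_gt 0 t with h | h
        · positivity
        · nlinarith
      exact_mod_cast (by positivity : 0 ≤ 4096 * (t * (t + 1)))
  have hfin := Finset.sum_le_sum fun χ (_ : χ ∈ Finset.univ) => hlow χ
  rw [hre, ← Finset.mul_sum, Finset.sum_boole, hcount] at hfin
  have hk0' : (E.card : ℝ) ≤ 1213 := by exact_mod_cast hk0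
  simp at hfin
  nlinarith

/-- there is no nontrivial regular `(2985984, 622440, 128952, 129960)`
partial difference set in any abelian group of order `2985984 = 2¹²·3⁶`; i.e. every such
regular PDS is trivial. -/
theorem no_nontrivial_pds_case10
    (G : Type*) [CommGroup G] (D : Set G)
    (hpds : IsPDS D 2985984 622440 128952 129960)
    (hreg : IsRegularPDS D) :
    IsTrivialPDS D := by
  classical
  exfalso
  obtain ⟨hv, hk, hl, hm⟩ := hpds
  obtain ⟨h1, hinv⟩ := hreg
  haveI : Finite G := Nat.finite_of_card_ne_zero (by rw [hv]; norm_num)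
  haveI := Fintype.ofFinite G
  obtain ⟨K, hK⟩ := Sylow.exists_subgroup_card_pow_prime (G := G) 2 (n := 12)
    (by rw [hv]; norm_num)
  let D' : Finset (Additive G) := Finset.univ.filter fun a => a.toMul ∈ D
  have hmem : ∀ a, a ∈ D' ↔ a.toMul ∈ D := by intro a; simp [D']
  have hcard : ∀ z : Additive G, z ≠ 0 →
      ((D' ×ˢ D').filter (fun p => p.1 - p.2 = z)).card =
      {p : G × G | p.1 ∈ D ∧ p.2 ∈ D ∧ p.1 ≠ p.2 ∧ p.1 * p.2⁻¹ = z.toMul}.ncard := by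
    intro z hz
    rw [← Set.ncard_coe_finset]
    refine Set.ncard_congr (fun p _ => (p.1.toMul, p.2.toMul)) ?_ ?_ ?_
    · rintro ⟨a, b⟩ h
      simp only [Finset.coe_filter, Finset.mem_product, hmem, Set.mem_setOf_eq] at h ⊢
      obtain ⟨⟨ha, hb⟩, rfl⟩ := h
      refine ⟨ha, hb, ?_, ?_⟩
      · intro hab
        exact hz (sub_eq_zero.2 (Additive.toMul.injective hab))
      · rw [toMul_sub, div_eq_mul_inv]
    · rintro ⟨a, b⟩ ⟨c, d⟩ _ _ h
      simpa using h
    · rintro ⟨a, b⟩ ⟨ha, hb, _, h⟩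
      refine ⟨(Additive.ofMul a, Additive.ofMul b), ?_, rfl⟩
      simp only [Finset.coe_filter, Finset.mem_product, hmem, Set.mem_setOf_eq]
      refine ⟨⟨ha, hb⟩, ?_⟩
      apply Additive.toMul.injective
      rw [toMul_sub, div_eq_mul_inv]
      exact h
  refine pds_core D' ?_ ?_ ?_ ?_ ?_ ?_ (Subgroup.toAddSubgroup K) ?_
  · rw [← Nat.card_eq_fintype_card]
    exact hv
  · rw [← hk, ← Set.ncard_coe_finset]
    refine Set.ncard_congr (fun p _ => p.toMul) ?_ ?_ ?_
    · intro a h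
      exact (hmem a).1 h
    · intro a b _ _ h
      exact Additive.toMul.injective h
    · intro a h
      exact ⟨Additive.ofMul a, (hmem _).2 h, rfl⟩
  · rw [hmem]; exact h1
  · intro a ha
    rw [hmem] at ha ⊢
    exact hinv _ ha
  · intro z hz hzD
    rw [hcard z hz]
    exact hl z.toMul hz ((hmem z).1 hzD)
  · intro z hz hzD
    rw [hcard z hz]
    exact hm z.toMul hz (fun h => hzD ((hmem z).2 h))
  · have : Nat.card K = 4096 := by rw [hK]; norm_num
    exact this
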